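/- Let x > 0 and N ≥ 1. Then x ∈ ∪_{n=1}^N D_n if and only if q_s(x) ≤ q_N. -/

import Mathlib

open Filter Topology

noncomputable section

/-- The value `Σ_{i≥0} d i / q^(i+1)` of a (0-indexed) digit sequence `d` in base `q`;
this corresponds to `((d_i)_{i≥1})_q` with `d_i = d (i-1)`. -/
def seqVal (q : ℝ) (d : ℕ → ℕ) : ℝ := ∑' i : ℕ, (d i : ℝ) / q ^ (i + 1)

/-- `d` is a `q`-expansion of `x` with digits in `{0,1}`. -/
def IsExpansion (q x : ℝ) (d : ℕ → ℕ) : Prop :=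
  (∀ i, d i ≤ 1) ∧ x = seqVal q d

/-- `x` has a unique `q`-expansion. -/
def HasUniqueExpansion (q x : ℝ) : Prop := ∃! d : ℕ → ℕ, IsExpansion q x d

/-- The set `U(x)` of univoque bases of `x`. -/
def UBases (x : ℝ) : Set ℝ := {q | 1 < q ∧ q < 2 ∧ HasUniqueExpansion q x}

/-- `q_s(x) = inf U(x)`. -/
def qs (x : ℝ) : ℝ := sInf (UBases x)

/-- The univoque set `U_q` of `x ∈ [0, 1/(q-1)]` with a unique `q`-expansion. -/
def Uset (q : ℝ) : Set ℝ :=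
  {x | x ∈ Set.Icc 0 (1 / (q - 1)) ∧ HasUniqueExpansion q x}

/-- The set `U_q'` of digit sequences which are the unique `q`-expansion of their value. -/
def USeq (q : ℝ) : Set (ℕ → ℕ) :=
  {d | (∀ i, d i ≤ 1) ∧ ∀ e : ℕ → ℕ, IsExpansion q (seqVal q d) e → e = d}

/-- The Thue–Morse sequence: `τ 0 = 0`, `τ (2n) = τ n`, `τ (2n+1) = 1 - τ n`. -/
def IsThueMorse (τ : ℕ → ℕ) : Prop :=
  τ 0 = 0 ∧ (∀ n, τ (2 * n) = τ n) ∧ ∀ n, τ (2 * n + 1) = 1 - τ n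

/-- `q` is the Komornik–Loreti constant: the base in `(1,2)` with `1 = Σ_{i≥1} τ_i q^{-i}`. -/
def IsKL (τ : ℕ → ℕ) (q : ℝ) : Prop :=
  1 < q ∧ q < 2 ∧ (1 : ℝ) = ∑' i : ℕ, (τ (i + 1) : ℝ) / q ^ (i + 1)

/-- `Q` is the sequence of bases `q_n`: `Q 0 = 1` and for `n ≥ 1`, `Q n` is the root in
`(1,2)` of `1 = Σ_{i=1}^{2^n} τ_i q^{-i}`. -/
def IsBaseSeq (τ : ℕ → ℕ) (Q : ℕ → ℝ) : Prop :=
  Q 0 = 1 ∧ ∀ n, 1 ≤ n → 1 < Q n ∧ Q n < 2 ∧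
    (1 : ℝ) = ∑ i ∈ Finset.range (2 ^ n), (τ (i + 1) : ℝ) / (Q n) ^ (i + 1)

/-- `D_n = ⋃_{q ∈ (q_{n-1}, q_n]} U_q`. -/
def D (Q : ℕ → ℝ) (n : ℕ) : Set ℝ := ⋃ q ∈ Set.Ioc (Q (n - 1)) (Q n), Uset q

/-- The golden ratio. -/
def qG : ℝ := (1 + Real.sqrt 5) / 2

/-- Strict lexicographical order on digit sequences. -/
def seqLt (c d : ℕ → ℕ) : Prop := ∃ n, (∀ i, i < n → c i = d i) ∧ c n < d n

/-- The word `τ_1 ⋯ τ_m`. -/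
def tmPrefix (τ : ℕ → ℕ) (m : ℕ) : List ℕ := (List.range m).map fun i => τ (i + 1)

/-- `w⁻`: decrease the last digit of a word by 1. -/
def lastDec (w : List ℕ) : List ℕ := w.dropLast ++ [w.getLastD 0 - 1]

/-- `w⁺`: increase the last digit of a word by 1. -/
def lastInc (w : List ℕ) : List ℕ := w.dropLast ++ [w.getLastD 0 + 1]

/-- The reflection of a word. -/
def reflect (w : List ℕ) : List ℕ := w.map fun d => 1 - d

/-- The infinite sequence given by the prefix `p` followed by periodic repetition of `w`. -/
def prefPeriodic (p w : List ℕ) : ℕ → ℕ := fun j =>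
  if j < p.length then p.getD j 0 else w.getD ((j - p.length) % w.length) 0

/-- `z_n = ((τ_1⋯τ_{2^{n-1}})(τ_{2^{n-1}+1}⋯τ_{2^n})^∞)_{q_n}`. -/
def zVal (τ : ℕ → ℕ) (Q : ℕ → ℝ) (n : ℕ) : ℝ :=
  seqVal (Q n) (prefPeriodic (tmPrefix τ (2 ^ (n - 1)))
    ((List.range (2 ^ (n - 1))).map fun i => τ (2 ^ (n - 1) + (i + 1))))

/-- `z_{1,k} = Σ_{i=1}^k q_G^{-i} + 1/(q_G^k (q_G^2 - 1))`. -/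
def z1 (k : ℕ) : ℝ :=
  (∑ i ∈ Finset.range k, 1 / qG ^ (i + 1)) + 1 / (qG ^ k * (qG ^ 2 - 1))

namespace Exp

def Dig (d : ℕ → ℕ) : Prop := ∀ i, d i ≤ 1
def sh (n : ℕ) (d : ℕ → ℕ) : ℕ → ℕ := fun i => d (i + n)
def cpl (d : ℕ → ℕ) : ℕ → ℕ := fun i => 1 - d i

lemma Dig.sh {d : ℕ → ℕ} (h : Dig d) (n : ℕ) : Dig (sh n d) := fun i => h _
lemma Dig.cpl (d : ℕ → ℕ) : Dig (cpl d) := fun i => by simp [Exp.cpl]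
lemma cpl_cpl {d : ℕ → ℕ} (h : Dig d) : cpl (cpl d) = d := by
  funext i; have := h i; simp only [cpl]; omega
lemma sh_cpl (n : ℕ) (d : ℕ → ℕ) : sh n (cpl d) = cpl (sh n d) := rfl
lemma sh_sh (n m : ℕ) (d : ℕ → ℕ) : sh n (sh m d) = sh (n + m) d := by
  funext i; simp [sh, add_assoc]

lemma summ_geo {q : ℝ} (hq : 1 < q) : Summable fun i : ℕ => 1 / q ^ (i + 1) := by
  have h := (summable_geometric_of_lt_one (r := 1 / q) (by positivity)
    (by rw [div_lt_one (by linarith)]; exact hq))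
  have := (summable_nat_add_iff 1).2 h
  refine this.congr fun i => by rw [one_div_pow]

lemma summ {q : ℝ} (hq : 1 < q) {d : ℕ → ℕ} (hd : Dig d) :
    Summable fun i : ℕ => (d i : ℝ) / q ^ (i + 1) := by
  have hq0 : 0 < q := by linarith
  refine Summable.of_nonneg_of_le (fun i => by positivity) (fun i => ?_) (summ_geo hq)
  have : (d i : ℝ) ≤ 1 := by exact_mod_cast hd i
  gcongr

lemma V_split {q : ℝ} (hq : 1 < q) {d : ℕ → ℕ} (hd : Dig d) (n : ℕ) :
    seqVal q d = ∑ i ∈ Finset.range n, (d i : ℝ) / q ^ (i + 1) + seqVal q (sh n d) / q ^ n := by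
  have hq0 : q ≠ 0 := by linarith
  rw [seqVal, ← (summ hq hd).sum_add_tsum_nat_add n, seqVal, ← tsum_div_const]
  congr 1
  refine tsum_congr fun i => ?_
  simp only [sh]
  rw [div_div, ← pow_add]
  congr 2; ring

lemma V_nonneg {q : ℝ} (hq : 1 < q) (d : ℕ → ℕ) : 0 ≤ seqVal q d := by
  have hq0 : 0 < q := by linarith
  exact tsum_nonneg fun i => by positivity

lemma V_ones {q : ℝ} (hq : 1 < q) : seqVal q (fun _ => 1) = 1 / (q - 1) := by
  have h := V_split hq (d := fun _ => 1) (fun i => le_rfl) 1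
  have : sh 1 (fun _ => 1) = fun _ => 1 := rfl
  rw [this] at h
  have h1 : q - 1 ≠ 0 := by linarith
  have h2 : q ≠ 0 := by linarith
  simp at h
  field_simp at h ⊢
  linarith

lemma V_cpl {q : ℝ} (hq : 1 < q) {d : ℕ → ℕ} (hd : Dig d) :
    seqVal q (cpl d) = 1 / (q - 1) - seqVal q d := by
  rw [← V_ones hq, seqVal, seqVal, seqVal,
    ← (summ hq (d := fun _ => 1) (fun i => le_rfl)).tsum_sub (summ hq hd)]
  refine tsum_congr fun i => ?_
  rw [cpl, Nat.cast_sub (hd i)]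
  ring

lemma V_le {q : ℝ} (hq : 1 < q) {d : ℕ → ℕ} (hd : Dig d) : seqVal q d ≤ 1 / (q - 1) := by
  have := V_cpl hq hd
  have := V_nonneg hq (cpl d)
  linarith

lemma V_diff {q : ℝ} (hq : 1 < q) {c d : ℕ → ℕ} (hc : Dig c) (hd : Dig d) (m : ℕ)
    (h : ∀ i < m, c i = d i) :
    seqVal q c - seqVal q d = (((c m : ℝ) + seqVal q (sh (m+1) c)) -
      ((d m : ℝ) + seqVal q (sh (m+1) d))) / q ^ (m+1) := by
  rw [V_split hq hc (m+1), V_split hq hd (m+1), Finset.sum_range_succ, Finset.sum_range_succ]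
  have : ∑ i ∈ Finset.range m, (c i : ℝ) / q ^ (i + 1)
      = ∑ i ∈ Finset.range m, (d i : ℝ) / q ^ (i + 1) :=
    Finset.sum_congr rfl fun i hi => by rw [h i (Finset.mem_range.1 hi)]
  rw [this]; ring

lemma V_ge_digit {q : ℝ} (hq : 1 < q) {d : ℕ → ℕ} (hd : Dig d) (m : ℕ) (h : d m = 1) :
    1 / q ^ (m+1) ≤ seqVal q d := by
  have hq0 : 0 < q := by linarith
  have := (summ hq hd).le_tsum m (fun i _ => by positivity)
  simpa [h, seqVal] using this

lemma V_anti {q q' : ℝ} (hq : 1 < q) (hqq : q ≤ q') {d : ℕ → ℕ} (hd : Dig d) :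
    seqVal q' d ≤ seqVal q d := by
  have hq0 : 0 < q := by linarith
  refine (summ (by linarith) hd).tsum_le_tsum (fun i => ?_) (summ hq hd)
  gcongr

lemma V_anti_digit {q q' : ℝ} (hq : 1 < q) (hqq : q ≤ q') {d : ℕ → ℕ} (hd : Dig d) (m : ℕ)
    (h : d m = 1) :
    seqVal q' d + (1 / q ^ (m+1) - 1 / q' ^ (m+1)) ≤ seqVal q d := by
  have hq0 : 0 < q := by linarith
  have hs := summ hq hd
  have hs' := summ (q := q') (by linarith) hd
  have := (hs.sub hs').le_tsum m (fun i _ => by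
    rw [sub_nonneg]; gcongr)
  rw [hs.tsum_sub hs'] at this
  simp only [h, Nat.cast_one] at this
  simp only [seqVal]
  linarith

lemma V_strictAnti {q q' : ℝ} (hq : 1 < q) (hqq : q < q') {d : ℕ → ℕ} (hd : Dig d) 
    (hpos : 0 < seqVal q d) : seqVal q' d < seqVal q d := by
  have hq0 : 0 < q := by linarith
  have : ∃ m, d m = 1 := by
    by_contra! hne
    have : ∀ i, d i = 0 := fun i => by have := hd i; have := hne i; omega
    simp [seqVal, this] at hpos
  obtain ⟨m, hm⟩ := this
  have h1 := V_anti_digit hq hqq.le hd m hm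
  have : 1 / q' ^ (m+1) < 1 / q ^ (m+1) := by gcongr
  linarith

/-- Existence of expansions. -/
lemma exists_exp {q : ℝ} (hq : 1 < q) (hq2 : q < 2) {v : ℝ} (h0 : 0 ≤ v) (h1 : v ≤ 1 / (q - 1)) :
    ∃ d, Dig d ∧ v = seqVal q d := by
  classical
  have hq0 : 0 < q := by linarith
  have hq1 : 0 < q - 1 := by linarith
  let dg : ℝ → ℕ := fun y => if 1 ≤ q * y then 1 else 0
  let y : ℕ → ℝ := fun n => Nat.rec v (fun _ y => q * y - dg y) n
  have ys : ∀ n, y (n+1) = q * y n - dg (y n) := fun n => rfl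
  have hb : ∀ n, 0 ≤ y n ∧ y n ≤ 1 / (q - 1) := by
    intro n
    induction n with
    | zero => exact ⟨h0, h1⟩
    | succ n ih =>
      rw [ys]
      obtain ⟨a, b⟩ := ih
      rw [le_div_iff₀ hq1] at b ⊢
      by_cases h : 1 ≤ q * y n
      · simp only [dg, h, if_true, Nat.cast_one]
        constructor
        · linarith
        · nlinarith
      · simp only [dg, h, if_false, Nat.cast_zero]
        push Not at h
        have := mul_nonneg hq0.le a
        constructor
        · linarith
        · nlinarith
  have hd : Dig fun n => dg (y n) := by
    intro n; simp only [dg]; split_ifs <;> simp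
  have hsum : ∀ n, v = ∑ i ∈ Finset.range n, (dg (y i) : ℝ) / q ^ (i + 1) + y n / q ^ n := by
    intro n
    induction n with
    | zero => simp [y]
    | succ n ih =>
      rw [Finset.sum_range_succ, ys, ih]
      field_simp
      ring
  refine ⟨fun n => dg (y n), hd, ?_⟩
  have t1 := (summ hq hd).hasSum.tendsto_sum_nat
  have t2 : Tendsto (fun n => y n / q ^ n) atTop (𝓝 0) := by
    have : Tendsto (fun n : ℕ => (1 / (q - 1)) * (1 / q) ^ n) atTop (𝓝 ((1 / (q - 1)) * 0)) :=
      (tendsto_pow_atTop_nhds_zero_of_lt_one (by positivity)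
        (by rw [div_lt_one hq0]; exact hq)).const_mul _
    rw [mul_zero] at this
    refine squeeze_zero (fun n => div_nonneg (hb n).1 (by positivity)) (fun n => ?_) this
    rw [one_div_pow, mul_one_div]
    gcongr
    exact (hb n).2
  have t3 := t1.add t2
  rw [add_zero] at t3
  have t4 : Tendsto (fun n => ∑ i ∈ Finset.range n, (dg (y i) : ℝ) / q ^ (i + 1) + y n / q ^ n)
    atTop (𝓝 v) := by
    refine tendsto_const_nhds.congr hsum
  exact tendsto_nhds_unique t4 t3

def GoodH (q : ℝ) (d : ℕ → ℕ) : Prop := ∀ n, d n = 0 → seqVal q (sh (n+1) d) < 1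
def Good (q : ℝ) (d : ℕ → ℕ) : Prop := GoodH q d ∧ GoodH q (cpl d)

lemma Good.cpl {q : ℝ} {d : ℕ → ℕ} (hd : Dig d) (h : Good q d) : Good q (cpl d) :=
  ⟨h.2, by rw [cpl_cpl hd]; exact h.1⟩

lemma first_diff {c d : ℕ → ℕ} (h : c ≠ d) : ∃ m, (∀ i < m, c i = d i) ∧ c m ≠ d m := by
  classical
  have : ∃ m, c m ≠ d m := by
    by_contra! h'; exact h (funext h')
  exact ⟨Nat.find this, fun i hi => by simpa using Nat.find_min this hi, Nat.find_spec this⟩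

lemma good_unique {q : ℝ} (hq : 1 < q) {d : ℕ → ℕ} (hd : Dig d) (h : Good q d) :
    HasUniqueExpansion q (seqVal q d) := by
  refine ⟨d, ⟨hd, rfl⟩, fun e he => ?_⟩
  obtain ⟨he1, he2⟩ := he
  have he1 : Dig e := he1
  by_contra hne
  obtain ⟨m, hm1, hm2⟩ := first_diff hne
  have h1 := V_diff hq he1 hd m hm1
  have hqp : 0 < q ^ (m+1) := by have : 0 < q := by linarith
                                 positivity
  rw [← he2, sub_self, eq_comm, div_eq_zero_iff] at h1
  have h1 := h1.resolve_right hqp.ne'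
  have a := V_nonneg hq (sh (m+1) e)
  have b := V_le hq (he1.sh (m+1))
  have e1 := he1 m
  have d1 := hd m
  rcases Nat.lt_or_ge (d m) (e m) with hlt | hge
  · have d0 : d m = 0 := by omega
    have e0 : e m = 1 := by omega
    have := h.1 m d0
    rw [d0, e0] at h1
    push_cast at h1
    linarith
  · have d0 : d m = 1 := by omega
    have e0 : e m = 0 := by omega
    have := h.2 m (by simp [Exp.cpl, d0])
    rw [sh_cpl, V_cpl hq (hd.sh _)] at this
    rw [d0, e0] at h1
    push_cast at h1
    linarith

lemma unique_goodH {q : ℝ} (hq : 1 < q) (hq2 : q < 2) {d : ℕ → ℕ} (hd : Dig d)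
    (h : ∀ e, Dig e → seqVal q d = seqVal q e → e = d) : GoodH q d := by
  intro n hn
  by_contra! hge
  have b := V_le hq (hd.sh (n+1))
  obtain ⟨e, he, hev⟩ := exists_exp hq hq2 (v := seqVal q (sh (n+1) d) - 1) (by linarith)
    (by linarith)
  let f : ℕ → ℕ := fun i => if i < n then d i else if i = n then 1 else e (i - (n+1))
  have hf : Dig f := by
    intro i; simp only [f]; split_ifs
    · exact hd i
    · exact le_rfl
    · exact he _
  have hsf : sh (n+1) f = e := by
    funext i
    simp only [sh, f]
    rw [if_neg (by omega), if_neg (by omega)]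
    congr 1
    omega
  have hfn : f n = 1 := by simp [f]
  have hfd := V_diff hq hf hd n (fun i hi => by simp [f, hi])
  rw [hsf, ← hev, hfn, hn] at hfd
  have : seqVal q d = seqVal q f := by
    push_cast at hfd
    have : seqVal q f - seqVal q d = 0 := by rw [hfd]; ring
    linarith
  have := h f hf this
  rw [this] at hfn
  omega

lemma unique_iff {q : ℝ} (hq : 1 < q) (hq2 : q < 2) (x : ℝ) :
    HasUniqueExpansion q x ↔ ∃ d, Dig d ∧ x = seqVal q d ∧ Good q d := by
  constructor
  · rintro ⟨d, ⟨hd, rfl⟩, h⟩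
    have hd : Dig d := hd
    have h' : ∀ e, Dig e → seqVal q d = seqVal q e → e = d := fun e he hh => h e ⟨he, hh⟩
    refine ⟨d, hd, rfl, unique_goodH hq hq2 hd h', unique_goodH hq hq2 (Dig.cpl d) ?_⟩
    intro e he hh
    have := h' (cpl e) (Dig.cpl e) (by rw [V_cpl hq he, ← hh, V_cpl hq hd]; ring)
    rw [← this, cpl_cpl he]
  · rintro ⟨d, hd, rfl, h⟩
    exact good_unique hq hd h

/-! Lexicographic part -/

def WeakH (β d : ℕ → ℕ) : Prop := ∀ n, d n = 0 → ¬ seqLt β (sh (n+1) d)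
def Weak (β d : ℕ → ℕ) : Prop := WeakH β d ∧ WeakH β (cpl d)
def StrictH (β d : ℕ → ℕ) : Prop := ∀ n, d n = 0 → seqLt (sh (n+1) d) β
def Strict (β d : ℕ → ℕ) : Prop := StrictH β d ∧ StrictH β (cpl d)

lemma tri (c d : ℕ → ℕ) : c = d ∨ seqLt c d ∨ seqLt d c := by
  by_cases h : c = d
  · exact Or.inl h
  · obtain ⟨m, h1, h2⟩ := first_diff h
    rcases lt_or_gt_of_ne h2 with h3 | h3
    · exact Or.inr (Or.inl ⟨m, h1, h3⟩)
    · exact Or.inr (Or.inr ⟨m, fun i hi => (h1 i hi).symm, h3⟩)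

lemma not_both {c d : ℕ → ℕ} (h : seqLt c d) (h' : seqLt d c) : False := by
  obtain ⟨m, h1, h2⟩ := h
  obtain ⟨n, h3, h4⟩ := h'
  rcases lt_trichotomy m n with h | h | h
  · have := h3 m h; omega
  · subst h; omega
  · have := h1 n h; omega

lemma StrictH.weak {β d : ℕ → ℕ} (h : StrictH β d) : WeakH β d :=
  fun n hn h' => not_both h' (h n hn)
lemma Strict.weak {β d : ℕ → ℕ} (h : Strict β d) : Weak β d := ⟨h.1.weak, h.2.weak⟩
lemma Weak.cpl {β d : ℕ → ℕ} (hd : Dig d) (h : Weak β d) : Weak β (cpl d) :=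
  ⟨h.2, by rw [cpl_cpl hd]; exact h.1⟩
lemma Strict.cpl {β d : ℕ → ℕ} (hd : Dig d) (h : Strict β d) : Strict β (cpl d) :=
  ⟨h.2, by rw [cpl_cpl hd]; exact h.1⟩

lemma not_seqLt_self (c : ℕ → ℕ) : ¬ seqLt c c := fun h => not_both h h

/-- Step 1. -/
lemma good_strictH {q : ℝ} (hq : 1 < q) {d β : ℕ → ℕ} (hd : Dig d) (hβ : Dig β)
    (h1 : 1 ≤ seqVal q β) (h : Good q d) : StrictH β d := by
  intro n hn
  have hg := h.1 n hn
  rcases tri (sh (n+1) d) β with h2 | h2 | h2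
  · rw [h2] at hg; linarith
  · exact h2
  · exfalso
    obtain ⟨m, h3, h4⟩ := h2
    have h5 : sh (n+1) d m ≤ 1 := hd.sh _ _
    have b0 : β m = 0 := by omega
    have d0 : sh (n+1) d m = 1 := by omega
    have hv := V_diff hq (hd.sh (n+1)) hβ m (fun i hi => (h3 i hi).symm)
    rw [b0, d0, sh_sh] at hv
    have h6 := h.2 (m + (n+1)) (by simp only [sh] at d0; simp [Exp.cpl, d0])
    rw [sh_cpl, V_cpl hq (hd.sh _)] at h6
    have h7 := V_le hq (hβ.sh (m+1))
    have e : m + 1 + (n+1) = m + (n+1) + 1 := by ring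
    rw [e] at hv
    have hqp : 0 < q ^ (m+1) := by have : 0 < q := by linarith
                                   positivity
    have : 0 ≤ seqVal q (sh (n+1) d) - seqVal q β := by
      rw [hv]; apply div_nonneg _ hqp.le
      push_cast; linarith
    linarith

lemma good_strict {q : ℝ} (hq : 1 < q) {d β : ℕ → ℕ} (hd : Dig d) (hβ : Dig β)
    (h1 : 1 ≤ seqVal q β) (h : Good q d) : Strict β d :=
  ⟨good_strictH hq hd hβ h1 h, good_strictH hq (Dig.cpl d) hβ h1 (h.cpl hd)⟩

/-- Step 3. -/
lemma strictH_good {q : ℝ} (hq : 1 < q) {d β : ℕ → ℕ} (hd : Dig d) (hβ : Dig β)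
    (h1 : seqVal q β = 1) (hinf : ∀ m, ∃ k, m ≤ k ∧ β k = 1) (h : StrictH β d) : GoodH q d := by
  have hq0 : 0 < q := by linarith
  have key : ∀ n, d n = 0 → ∃ n' m, d n' = 0 ∧
      seqVal q (sh (n+1) d) - 1 < (seqVal q (sh (n'+1) d) - 1) / q ^ (m+1) := by
    intro n hn
    obtain ⟨m, h3, h4⟩ := h n hn
    have h5 := hβ m
    have b0 : β m = 1 := by omega
    have d0 : sh (n+1) d m = 0 := by omega
    refine ⟨m + (n+1), m, d0, ?_⟩
    have hv := V_diff hq (hd.sh (n+1)) hβ m h3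
    have e : m + 1 + (n+1) = m + (n+1) + 1 := by ring
    rw [b0, d0, sh_sh, h1, e] at hv
    rw [hv]
    have : 0 < seqVal q (sh (m+1) β) := by
      obtain ⟨k, hk, hk1⟩ := hinf (m+1)
      have := V_ge_digit hq (hβ.sh (m+1)) (k - (m+1)) (by
        simp only [sh]; rw [Nat.sub_add_cancel hk]; exact hk1)
      have h' : 0 < 1 / q ^ (k - (m+1) + 1) := by positivity
      linarith
    have hqp : 0 < q ^ (m+1) := by positivity
    rw [div_lt_div_iff_of_pos_right hqp]
    push_cast; linarith
  have bound : ∀ k n, d n = 0 → seqVal q (sh (n+1) d) - 1 ≤ (1 / (q-1)) / q ^ k := by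
    intro k
    have hp : 0 < 1 / (q - 1) := by have : 0 < q - 1 := by linarith
                                    positivity
    induction k with
    | zero => intro n _; have := V_le hq (hd.sh (n+1)); simp at this ⊢; linarith
    | succ k ih =>
      intro n hn
      obtain ⟨n', m, hn', hlt⟩ := key n hn
      refine hlt.le.trans ?_
      have h6 := ih n' hn'
      calc (seqVal q (sh (n'+1) d) - 1) / q ^ (m+1) ≤ ((1 / (q-1)) / q ^ k) / q ^ (m+1) := by
            gcongr
        _ ≤ ((1 / (q-1)) / q ^ k) / q ^ 1 := by
            gcongr
            · exact hq.le
            · omega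
        _ = _ := by rw [div_div _ (q^k), ← pow_add]
  have le0 : ∀ n, d n = 0 → seqVal q (sh (n+1) d) - 1 ≤ 0 := by
    intro n hn
    have : Tendsto (fun n : ℕ => (1 / (q - 1)) * (1 / q) ^ n) atTop (𝓝 ((1 / (q - 1)) * 0)) :=
      (tendsto_pow_atTop_nhds_zero_of_lt_one (by positivity)
        (by rw [div_lt_one hq0]; exact hq)).const_mul _
    rw [mul_zero] at this
    refine ge_of_tendsto' this fun k => ?_
    rw [one_div_pow, mul_one_div]
    exact bound k n hn
  intro n hn
  obtain ⟨n', m, hn', hlt⟩ := key n hn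
  have := div_nonpos_of_nonpos_of_nonneg (le0 n' hn') (by positivity : 0 ≤ q ^ (m+1))
  linarith

lemma strict_good {q : ℝ} (hq : 1 < q) {d β : ℕ → ℕ} (hd : Dig d) (hβ : Dig β)
    (h1 : seqVal q β = 1) (hinf : ∀ m, ∃ k, m ≤ k ∧ β k = 1) (h : Strict β d) : Good q d :=
  ⟨strictH_good hq hd hβ h1 hinf h.1, strictH_good hq (Dig.cpl d) hβ h1 hinf h.2⟩

/-- Lemma A. -/
lemma lemA {β d : ℕ → ℕ} {L : ℕ} (hL : 1 ≤ L) (hd : Dig d) (hβ : Dig β)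
    (hβ1 : β (L - 1) = 1) (hβ2 : ∀ i, β (i + L) = 1 - β i)
    (h : Weak β d) {n : ℕ} (hn : d n = 0) (hpre : ∀ i < L, sh (n+1) d i = β i) :
    sh (n+1) d = β := by
  rcases tri (sh (n+1) d) β with h2 | h2 | h2
  · exact h2
  · exfalso
    obtain ⟨m, h3, h4⟩ := h2
    have hm : L ≤ m := by
      by_contra! hlt; have := hpre m hlt; omega
    have h5 := hβ m
    have hL1 : d (n + L) = 1 := by
      have := hpre (L-1) (by omega)
      simp only [sh] at this
      rw [hβ1] at this
      rw [← this]; congr 1; omega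
    apply h.2 (n + L) (by simp [Exp.cpl, hL1])
    have eqd : ∀ i, sh (n+1) d (i + L) = d (i + (n + L + 1)) := by
      intro i; simp only [sh]; congr 1; omega
    refine ⟨m - L, fun i hi => ?_, ?_⟩
    · have a := h3 (i + L) (by omega)
      rw [hβ2, eqd] at a
      have := hβ i
      simp only [sh, Exp.cpl]
      omega
    · obtain ⟨k, rfl⟩ := Nat.exists_eq_add_of_le' hm
      rw [hβ2, eqd] at h4
      simp only [sh, Exp.cpl, Nat.add_sub_cancel]
      omega
  · exact absurd h2 (h.1 n hn)

/-- Step 2. -/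
lemma strictH_weakH {β γ d : ℕ → ℕ} {L : ℕ} (hL : 1 ≤ L) (hd : Dig d) (hβ : Dig β)
    (hβ1 : β (L - 1) = 1) (hβ2 : ∀ i, β (i + L) = 1 - β i)
    (hγ1 : ∀ i, γ (i + L) = γ i) (hγ2 : ∀ i, i + 1 < L → γ i = β i) (hγ3 : γ (L - 1) = 0)
    (h : Strict β d) : WeakH γ d := by
  suffices H : ∀ m n, d n = 0 → (∀ i < m, γ i = sh (n+1) d i) → γ m < sh (n+1) d m → False from
    fun n hn ⟨m, h1, h2⟩ => H m n hn h1 h2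
  intro m
  induction m using Nat.strong_induction_on with
  | _ m ih =>
    intro n hn h1 h2
    by_cases hm : L ≤ m
    · have eqd : ∀ i, sh (n+1) d (i + L) = sh (n + L + 1) d i := by
        intro i; simp only [sh]; congr 1; omega
      obtain ⟨k, rfl⟩ := Nat.exists_eq_add_of_le' hm
      refine ih k (by omega) (n + L) ?_ ?_ ?_
      · have := h1 (L - 1) (by omega)
        rw [hγ3] at this
        simp only [sh] at this
        rw [this]; congr 1; omega
      · intro i hi
        have := h1 (i + L) (by omega)
        rwa [hγ1, eqd] at this
      · rwa [hγ1, eqd] at h2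
    · by_cases hm2 : m + 1 < L
      · apply h.weak.1 n hn
        refine ⟨m, fun i hi => ?_, ?_⟩
        · rw [← hγ2 i (by omega)]; exact h1 i hi
        · rw [← hγ2 m hm2]; exact h2
      · have hm3 : m = L - 1 := by omega
        have h5 : sh (n+1) d m ≤ 1 := hd.sh _ _
        have := lemA hL hd hβ hβ1 hβ2 h.weak hn (fun i hi => by
          by_cases hi2 : i < m
          · rw [← h1 i hi2, hγ2 i (by omega)]
          · have : i = L - 1 := by omega
            rw [this, hβ1, ← hm3]; omega)
        have h6 := h.1 n hn
        rw [this] at h6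
        exact not_seqLt_self _ h6

lemma strict_weak {β γ d : ℕ → ℕ} {L : ℕ} (hL : 1 ≤ L) (hd : Dig d) (hβ : Dig β)
    (hβ1 : β (L - 1) = 1) (hβ2 : ∀ i, β (i + L) = 1 - β i)
    (hγ1 : ∀ i, γ (i + L) = γ i) (hγ2 : ∀ i, i + 1 < L → γ i = β i) (hγ3 : γ (L - 1) = 0)
    (h : Strict β d) : Weak γ d :=
  ⟨strictH_weakH hL hd hβ hβ1 hβ2 hγ1 hγ2 hγ3 h,
   strictH_weakH hL (Dig.cpl d) hβ hβ1 hβ2 hγ1 hγ2 hγ3 (h.cpl hd)⟩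


/-! Thue–Morse facts -/

lemma tm_le {τ : ℕ → ℕ} (hτ : IsThueMorse τ) : ∀ n, τ n ≤ 1 := by
  intro n
  induction n using Nat.strong_induction_on with
  | _ n ih =>
    obtain ⟨h0, h1, h2⟩ := hτ
    rcases Nat.even_or_odd' n with ⟨k, rfl | rfl⟩
    · rw [h1]
      by_cases hk : k = 0
      · subst hk; omega
      · exact ih k (by omega)
    · rw [h2]; omega

lemma tm_pow {τ : ℕ → ℕ} (hτ : IsThueMorse τ) : ∀ N, τ (2 ^ N) = 1 := by
  intro N
  obtain ⟨h0, h1, h2⟩ := hτ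
  induction N with
  | zero => have := h2 0; simp [h0] at this; simpa using this
  | succ N ih => rw [pow_succ, mul_comm, h1, ih]

lemma tm_add {τ : ℕ → ℕ} (hτ : IsThueMorse τ) :
    ∀ N i, i < 2 ^ N → τ (2 ^ N + i) = 1 - τ i := by
  intro N
  obtain ⟨h0, h1, h2⟩ := hτ
  induction N with
  | zero =>
    intro i hi
    have : i = 0 := by simpa using hi
    subst this
    have := h2 0
    simpa using this
  | succ N ih =>
    intro i hi
    rw [pow_succ] at hi
    rcases Nat.even_or_odd' i with ⟨k, rfl | rfl⟩
    · have e : 2 ^ (N+1) + 2 * k = 2 * (2 ^ N + k) := by ring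
      rw [e, h1, h1, ih k (by omega)]
    · have e : 2 ^ (N+1) + (2 * k + 1) = 2 * (2 ^ N + k) + 1 := by ring
      rw [e, h2, h2, ih k (by omega)]

def beta (τ : ℕ → ℕ) (N i : ℕ) : ℕ :=
  if (i / 2 ^ N) % 2 = 0 then τ (i % 2 ^ N + 1) else 1 - τ (i % 2 ^ N + 1)

lemma beta_dig {τ : ℕ → ℕ} (hτ : IsThueMorse τ) (N : ℕ) : Dig (beta τ N) := by
  intro i; unfold beta; split_ifs
  · exact tm_le hτ _
  · omega

lemma beta_lt (τ : ℕ → ℕ) {N i : ℕ} (h : i < 2 ^ N) : beta τ N i = τ (i + 1) := by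
  simp [beta, Nat.div_eq_of_lt h, Nat.mod_eq_of_lt h]

lemma beta_add {τ : ℕ → ℕ} (hτ : IsThueMorse τ) (N i : ℕ) :
    beta τ N (i + 2 ^ N) = 1 - beta τ N i := by
  have hp : 0 < 2 ^ N := by positivity
  have := tm_le hτ (i % 2 ^ N + 1)
  unfold beta
  rw [Nat.add_div_right _ hp, Nat.add_mod_right]
  split_ifs <;> omega

lemma beta_last {τ : ℕ → ℕ} (hτ : IsThueMorse τ) (N : ℕ) : beta τ N (2 ^ N - 1) = 1 := by
  have hp : 0 < 2 ^ N := by positivity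
  rw [beta_lt τ (by omega), Nat.sub_add_cancel hp, tm_pow hτ]

lemma beta_per {τ : ℕ → ℕ} (hτ : IsThueMorse τ) (N i : ℕ) :
    beta τ N (i + 2 ^ (N+1)) = beta τ N i := by
  have e : i + 2 ^ (N+1) = (i + 2 ^ N) + 2 ^ N := by ring
  have := beta_dig hτ N i
  rw [e, beta_add hτ, beta_add hτ]; omega

lemma beta_pre {τ : ℕ → ℕ} (hτ : IsThueMorse τ) {N i : ℕ} (h : i + 1 < 2 ^ (N+1)) :
    beta τ N i = τ (i + 1) := by
  by_cases hi : i < 2 ^ N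
  · exact beta_lt τ hi
  · obtain ⟨j, rfl⟩ := Nat.exists_eq_add_of_le' (not_lt.1 hi)
    rw [pow_succ] at h
    rw [beta_add hτ, beta_lt τ (by omega), ← tm_add hτ N (j+1) (by omega)]
    congr 1; ring

lemma beta_last0 {τ : ℕ → ℕ} (hτ : IsThueMorse τ) (N : ℕ) : beta τ N (2 ^ (N+1) - 1) = 0 := by
  have hp : 0 < 2 ^ N := by positivity
  have e : 2 ^ (N+1) - 1 = (2 ^ N - 1) + 2 ^ N := by rw [pow_succ]; omega
  rw [e, beta_add hτ, beta_last hτ]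

lemma beta_inf {τ : ℕ → ℕ} (hτ : IsThueMorse τ) (N m : ℕ) : ∃ k, m ≤ k ∧ beta τ N k = 1 := by
  have h1 := beta_add hτ N m
  have h2 := beta_dig hτ N m
  by_cases h : beta τ N m = 1
  · exact ⟨m, le_rfl, h⟩
  · exact ⟨m + 2 ^ N, Nat.le_add_right _ _, by omega⟩

lemma beta_val {τ : ℕ → ℕ} (hτ : IsThueMorse τ) {Q : ℕ → ℝ} (hQ : IsBaseSeq τ Q) (N : ℕ) :
    seqVal (Q (N+1)) (beta τ N) = 1 := by
  obtain ⟨h1, h2, h3⟩ := hQ.2 (N+1) (by omega)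
  set q := Q (N+1)
  have hs := V_split h1 (beta_dig hτ N) (2 ^ (N+1))
  have hsh : sh (2 ^ (N+1)) (beta τ N) = beta τ N := by
    funext i; exact beta_per hτ N i
  rw [hsh] at hs
  have hp : 0 < 2 ^ (N+1) := by positivity
  obtain ⟨L, hL⟩ : ∃ L, 2 ^ (N+1) = L + 1 := ⟨2 ^ (N+1) - 1, by omega⟩
  have hτL := tm_pow hτ (N+1)
  have hβL := beta_last0 hτ N
  have hpre : ∀ i < L, beta τ N i = τ (i+1) := fun i hi => beta_pre hτ (by omega)
  rw [hL] at hs h3 hτL hβL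
  rw [Nat.add_sub_cancel] at hβL
  rw [Finset.sum_range_succ] at hs h3
  rw [hβL, Finset.sum_congr rfl fun i hi => by rw [hpre i (Finset.mem_range.1 hi)]] at hs
  rw [hτL] at h3
  push_cast at hs h3
  have hq1 : 1 < q ^ (L+1) := one_lt_pow₀ h1 (by omega)
  have hne : 1 - 1 / q ^ (L+1) ≠ 0 := by
    have : 1 / q ^ (L+1) < 1 := by rw [div_lt_one (by linarith)]; exact hq1
    linarith
  have : (seqVal q (beta τ N) - 1) * (1 - 1 / q ^ (L+1)) = 0 := by
    rw [div_eq_mul_one_div (seqVal q (beta τ N))] at hs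
    have e : seqVal q (beta τ N) = (1 - 1 / q ^ (L+1)) +
      seqVal q (beta τ N) * (1 / q ^ (L+1)) := by
      linear_combination hs - h3
    linear_combination e
  have := (mul_eq_zero.1 this).resolve_right hne
  linarith

lemma Q_lt {τ : ℕ → ℕ} (hτ : IsThueMorse τ) {Q : ℕ → ℝ} (hQ : IsBaseSeq τ Q) (N : ℕ) :
    Q N < Q (N+1) := by
  obtain ⟨h1, h2, h3⟩ := hQ.2 (N+1) (by omega)
  rcases Nat.eq_zero_or_pos N with rfl | hN
  · rw [hQ.1]; exact h1
  obtain ⟨g1, g2, g3⟩ := hQ.2 N hN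
  by_contra! hle
  have hq0 : 0 < Q N := by linarith
  have hq0' : 0 < Q (N+1) := by linarith
  have a : ∑ i ∈ Finset.range (2 ^ (N+1)), (τ (i + 1) : ℝ) / (Q N) ^ (i + 1) ≤
      ∑ i ∈ Finset.range (2 ^ (N+1)), (τ (i + 1) : ℝ) / (Q (N+1)) ^ (i + 1) := by
    apply Finset.sum_le_sum; intro i _; gcongr
  have hp : 0 < 2 ^ N := by positivity
  have hpp : 2 ^ (N+1) = 2 ^ N + 2 ^ N := by ring
  have b : ∑ i ∈ Finset.range (2 ^ N), (τ (i + 1) : ℝ) / (Q N) ^ (i + 1) <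
      ∑ i ∈ Finset.range (2 ^ (N+1)), (τ (i + 1) : ℝ) / (Q N) ^ (i + 1) := by
    refine Finset.sum_lt_sum_of_subset (i := 2 ^ (N+1) - 1) ?_ ?_ ?_ ?_ ?_
    · apply Finset.range_subset_range.2; omega
    · rw [Finset.mem_range]; omega
    · rw [Finset.mem_range]; omega
    · rw [Nat.sub_add_cancel (by omega), tm_pow hτ]; push_cast; positivity
    · intros; positivity
  linarith

lemma Q_mono {τ : ℕ → ℕ} (hτ : IsThueMorse τ) {Q : ℕ → ℝ} (hQ : IsBaseSeq τ Q) : StrictMono Q :=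
  strictMono_nat_of_lt_succ (Q_lt hτ hQ)

/-! Limit argument -/

lemma weak_limitH {γ e : ℕ → ℕ} {d : ℕ → ℕ → ℕ}
    (hlim : ∀ i, ∀ᶠ k in atTop, d k i = e i) (hw : ∀ k, WeakH γ (d k)) : WeakH γ e := by
  rintro n hn ⟨m, h1, h2⟩
  have hall : ∀ᶠ k in atTop, ∀ i ∈ Finset.range (n + m + 2), d k i = e i :=
    (Filter.eventually_all_finset _).2 fun i _ => hlim i
  obtain ⟨k, hk⟩ := hall.exists
  have hk : ∀ i, i < n + m + 2 → d k i = e i := fun i hi => hk i (Finset.mem_range.2 hi)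
  apply hw k n (by rw [hk n (by omega), hn])
  refine ⟨m, fun i hi => ?_, ?_⟩
  · rw [h1 i hi]; simp only [sh]; rw [hk _ (by omega)]
  · simp only [sh] at h2 ⊢; rw [hk _ (by omega)]; exact h2

/-- rigidity: a limit that is weak but not strict is attained eventually. -/
lemma limitH {γ e : ℕ → ℕ} {d : ℕ → ℕ → ℕ} {L : ℕ} (hL : 1 ≤ L) (hγ : Dig γ)
    (hγ1 : γ (L - 1) = 1) (hγ2 : ∀ i, γ (i + L) = 1 - γ i)
    (hd : ∀ k, Dig (d k))
    (hlim : ∀ i, ∀ᶠ k in atTop, d k i = e i) (hw : ∀ k, Weak γ (d k)) :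
    StrictH γ e ∨ ∀ᶠ k in atTop, d k = e := by
  by_cases hs : StrictH γ e
  · exact Or.inl hs
  right
  have hwe : WeakH γ e := weak_limitH hlim fun k => (hw k).1
  unfold StrictH at hs
  push Not at hs
  obtain ⟨n, hn, hlt⟩ := hs
  have heq : sh (n+1) e = γ := by
    rcases tri (sh (n+1) e) γ with h | h | h
    · exact h
    · exact absurd h hlt
    · exact absurd h (hwe n hn)
  have hall : ∀ᶠ k in atTop, ∀ i ∈ Finset.range (n + L + 2), d k i = e i :=
    (Filter.eventually_all_finset _).2 fun i _ => hlim i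
  filter_upwards [hall] with k hk
  have hk : ∀ i, i < n + L + 2 → d k i = e i := fun i hi => hk i (Finset.mem_range.2 hi)
  have := lemA hL (hd k) hγ hγ1 hγ2 (hw k) (n := n) (by rw [hk n (by omega), hn]) (fun i hi => by
    rw [← heq]; simp only [sh]; exact hk _ (by omega))
  funext i
  by_cases hi : i < n + 1
  · exact hk i (by omega)
  · obtain ⟨j, rfl⟩ := Nat.exists_eq_add_of_le' (not_lt.1 hi)
    exact (congrFun this j).trans (congrFun heq j).symm

lemma attained {τ : ℕ → ℕ} (hτ : IsThueMorse τ) {Q : ℕ → ℝ} (hQ : IsBaseSeq τ Q)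
    {x : ℝ} (hx : 0 < x) (M : ℕ) (hne : (UBases x).Nonempty) (hqs : qs x = Q (M+1)) :
    Q (M+1) ∈ UBases x := by
  by_contra hnot
  obtain ⟨h1, h2, -⟩ := hQ.2 (M+1) (by omega)
  set q := Q (M+1) with hq
  have hbdd : BddBelow (UBases x) := ⟨1, fun q hq => hq.1.le⟩
  have hgt : ∀ u ∈ UBases x, q < u := fun u hu =>
    lt_of_le_of_ne (hqs ▸ csInf_le hbdd hu) (fun h => hnot (h ▸ hu))
  obtain ⟨u, -, hut, hu⟩ := exists_seq_tendsto_sInf hne hbdd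
  change Tendsto u atTop (𝓝 (qs x)) at hut
  rw [hqs] at hut
  have hev : ∀ᶠ k in atTop, u k < Q (M+2) := hut.eventually_lt_const (Q_lt hτ hQ (M+1))
  obtain ⟨K, hK⟩ := eventually_atTop.1 hev
  have hex : ∀ k, ∃ d, Dig d ∧ x = seqVal (u (k+K)) d ∧ Weak (beta τ M) d := by
    intro k
    obtain ⟨a, b, c⟩ := hu (k+K)
    obtain ⟨d, hd, hxd, hg⟩ := (unique_iff a b x).1 c
    refine ⟨d, hd, hxd, ?_⟩
    have hle := (hK (k+K) (by omega)).le
    have hv : 1 ≤ seqVal (u (k+K)) (beta τ (M+1)) := by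
      have := V_anti a hle (beta_dig hτ (M+1))
      rwa [beta_val hτ hQ (M+1)] at this
    have hs := good_strict a hd (beta_dig hτ (M+1)) hv hg
    exact strict_weak (L := 2 ^ (M+1)) Nat.one_le_two_pow hd (beta_dig hτ (M+1)) (beta_last hτ _)
      (beta_add hτ _) (beta_per hτ M)
      (fun i hi => by rw [beta_pre hτ hi, beta_lt τ (by omega)]) (beta_last0 hτ M) hs
  choose d hd hxd hw using hex
  have hcomp : IsCompact (Set.pi Set.univ fun _ : ℕ => Set.Iic (1 : ℕ)) :=
    isCompact_univ_pi fun _ => (Set.finite_Iic 1).isCompact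
  obtain ⟨e, he, φ, hφ, hlim⟩ := hcomp.tendsto_subseq (x := d) (fun k i _ => hd k i)
  have he : Dig e := fun i => he i trivial
  have hlim : ∀ i, ∀ᶠ k in atTop, d (φ k) i = e i := fun i => by
    have := (tendsto_pi_nhds.1 hlim) i
    rw [nhds_discrete, tendsto_pure] at this
    exact this
  have hut' : Tendsto (fun k => u (φ k + K)) atTop (𝓝 q) :=
    hut.comp ((tendsto_add_atTop_nat K).comp hφ.tendsto_atTop)
  have hxe : x = seqVal q e := by
    have : Tendsto (fun k => seqVal (u (φ k + K)) (d (φ k))) atTop (𝓝 (seqVal q e)) := by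
      unfold seqVal
      refine tendsto_tsum_of_dominated_convergence (summ_geo h1) (fun i => ?_) ?_
      · have t1 : Tendsto (fun k => (d (φ k) i : ℝ)) atTop (𝓝 (e i : ℝ)) :=
          tendsto_const_nhds.congr' ((hlim i).mono fun k hk => by simp [hk])
        exact t1.div (hut'.pow (i+1)) (by positivity)
      · refine Eventually.of_forall fun k i => ?_
        have hlt := hgt _ (hu (φ k + K))
        have hup : 0 < u (φ k + K) := by linarith
        rw [Real.norm_of_nonneg (by positivity)]
        have : (d (φ k) i : ℝ) ≤ 1 := by exact_mod_cast hd (φ k) i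
        gcongr
    refine tendsto_nhds_unique (tendsto_const_nhds.congr fun k => ?_) this
    exact hxd (φ k)
  have contra : ¬ ∀ᶠ k in atTop, d (φ k) = e := by
    intro h
    obtain ⟨k, hk⟩ := h.exists
    have h3 := V_strictAnti h1 (hgt _ (hu (φ k + K))) he (by rw [← hxe]; exact hx)
    rw [← hxe] at h3
    have := hxd (φ k)
    rw [hk] at this
    linarith
  have hS : Strict (beta τ M) e := by
    constructor
    · exact (limitH (L := 2 ^ M) Nat.one_le_two_pow (beta_dig hτ M) (beta_last hτ M) (beta_add hτ M)
        (fun k => hd (φ k)) hlim (fun k => hw (φ k))).resolve_right contra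
    · refine (limitH (L := 2 ^ M) (d := fun k => cpl (d (φ k))) Nat.one_le_two_pow
        (beta_dig hτ M) (beta_last hτ M) (beta_add hτ M)
        (fun k => Dig.cpl _) (fun i => ?_) (fun k => (hw (φ k)).cpl (hd _))).resolve_right ?_
      · filter_upwards [hlim i] with k hk
        simp [cpl, hk]
      · intro h
        apply contra
        filter_upwards [h] with k hk
        rw [← cpl_cpl (hd (φ k)), hk, cpl_cpl he]
  exact hnot ⟨h1, h2, (unique_iff h1 h2 x).2 ⟨e, he, hxe,
    strict_good h1 he (beta_dig hτ M) (beta_val hτ hQ M) (beta_inf hτ M) hS⟩⟩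

/-! Non-emptiness of `U(x)` -/

lemma continuousOn_V {q₁ : ℝ} (h1 : 1 < q₁) {d : ℕ → ℕ} (hd : Dig d) :
    ContinuousOn (fun q => seqVal q d) (Set.Icc q₁ 2) := by
  unfold seqVal
  refine continuousOn_tsum (u := fun i => 1 / q₁ ^ (i+1)) (fun i => ?_) (summ_geo h1) ?_
  · refine ContinuousOn.div continuousOn_const (continuousOn_id.pow _) fun q hq => ?_
    have hq0 : 0 < q := by linarith [hq.1]
    exact pow_ne_zero _ hq0.ne'
  · intro i q hq
    have hq0 : 0 < q := by linarith [hq.1]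
    rw [Real.norm_of_nonneg (by positivity)]
    have : (d i : ℝ) ≤ 1 := by exact_mod_cast hd i
    have := hq.1
    gcongr

def p01 : ℕ → ℕ := fun i => i % 2
lemma p01_dig : Dig p01 := fun i => by simp only [p01]; omega
lemma sh1_p01 : sh 1 p01 = cpl p01 := by funext i; simp only [sh, p01, cpl]; omega

lemma V_p01 {q : ℝ} (hq : 1 < q) : seqVal q p01 = 1 / (q ^ 2 - 1) := by
  have h1 := V_split hq p01_dig 1
  rw [sh1_p01, V_cpl hq p01_dig] at h1
  simp [p01] at h1
  have a : q - 1 ≠ 0 := by linarith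
  have b : q ^ 2 - 1 ≠ 0 := by nlinarith
  have c : q ≠ 0 := by linarith
  change seqVal q p01 = ((q-1)⁻¹ - seqVal q p01) / q at h1
  field_simp at h1 ⊢
  have e : (q - 1) * (seqVal q p01 * (q^2 - 1) - 1) = 0 := by linear_combination (q-1) * h1
  have := (mul_eq_zero.1 e).resolve_left a
  linarith

lemma V_cpl_p01_lt {q : ℝ} (hq : 15 / 8 ≤ q) : seqVal q (cpl p01) < 1 := by
  have h1 : 1 < q := by linarith
  rw [V_cpl h1 p01_dig, V_p01 h1]
  have a : 0 < q - 1 := by linarith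
  have b : 0 < q ^ 2 - 1 := by nlinarith
  rw [div_sub_div _ _ a.ne' b.ne', div_lt_one (by positivity)]
  have c : 0 < (q - 1) * (q ^ 2 - q - 1) := mul_pos a (by nlinarith)
  linarith

lemma UBases_nonempty {x : ℝ} (hx : 0 < x) : (UBases x).Nonempty := by
  rcases lt_or_ge 1 x with hx1 | hx1
  · have hq : 1 < 1 + 1 / x := by have : 0 < 1 / x := by positivity
                                  linarith
    have hq2 : 1 + 1 / x < 2 := by
      have : 1 / x < 1 := by rw [div_lt_one hx]; exact hx1
      linarith
    refine ⟨1 + 1 / x, hq, hq2, (unique_iff hq hq2 x).2 ⟨fun _ => 1, fun _ => le_rfl, ?_, ?_, ?_⟩⟩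
    · rw [V_ones hq]; field_simp; ring
    · intro n hn; simp at hn
    · intro n _; simp [sh, cpl, seqVal]
  classical
  let dg : ℝ → ℕ := fun y => if 1 < 2 * y then 1 else 0
  let y : ℕ → ℝ := fun n => Nat.rec x (fun _ y => 2 * y - dg y) n
  let b : ℕ → ℕ := fun n => dg (y n)
  have ys : ∀ n, y (n+1) = 2 * y n - b n := fun n => rfl
  have hb1 : ∀ n, 1 < 2 * y n → b n = 1 := fun n h => by simp [b, dg, h]
  have hb0 : ∀ n, ¬ 1 < 2 * y n → b n = 0 := fun n h => by simp only [b, dg, if_neg h]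
  have hy : ∀ n, 0 < y n ∧ y n ≤ 1 := by
    intro n
    induction n with
    | zero => exact ⟨hx, hx1⟩
    | succ n ih =>
      rw [ys]
      by_cases h : 1 < 2 * y n
      · rw [hb1 n h]; push_cast; constructor <;> linarith
      · rw [hb0 n h]; push_cast; constructor <;> linarith
  have hbd : Dig b := by
    intro n; simp only [b, dg]; split_ifs <;> simp
  have hby : ∀ n, b n = 1 → 1 / 2 < y n := by
    intro n hn
    by_contra h
    rw [hb0 n (by linarith)] at hn
    omega
  have hsum : ∀ n, x = ∑ i ∈ Finset.range n, (b i : ℝ) / 2 ^ (i + 1) + y n / 2 ^ n := by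
    intro n
    induction n with
    | zero => simp [y]
    | succ n ih =>
      rw [Finset.sum_range_succ, ys, ih]
      field_simp
      ring
  have hinf : ∀ m, ∃ k, m ≤ k ∧ b k = 1 := by
    intro m
    by_contra! h
    have h' : ∀ j, y (m + j) = 2 ^ j * y m := by
      intro j
      induction j with
      | zero => simp
      | succ j ih =>
        have h0 : b (m + j) = 0 := by
          have := h (m+j) (by omega); have := hbd (m+j); omega
        rw [← add_assoc, ys, h0, ih]; push_cast; ring
    obtain ⟨j, hj⟩ := pow_unbounded_of_one_lt (1 / y m) (one_lt_two (α := ℝ))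
    rw [div_lt_iff₀ (hy m).1, ← h'] at hj
    linarith [(hy (m+j)).2]
  obtain ⟨i0, -, hi0⟩ := hinf 0
  obtain ⟨n0, hn0, hbn0⟩ := hinf (i0 + 5)
  obtain ⟨n, hn, hbn⟩ := hinf (n0 + i0 + 5)
  let d : ℕ → ℕ := fun i => if i < n then b i else p01 (i - n)
  have hdlt : ∀ i, i < n → d i = b i := fun i hi => if_pos hi
  have hdge : ∀ i, d (i + n) = p01 i := fun i => by
    simp only [d]; rw [if_neg (by omega), Nat.add_sub_cancel]
  have hd : Dig d := by
    intro i; simp only [d]; split_ifs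
    · exact hbd i
    · exact p01_dig _
  have hshn : sh n d = p01 := funext hdge
  have hsumd : ∀ r ≤ n, ∀ q : ℝ, ∑ i ∈ Finset.range r, (d i : ℝ) / q ^ (i + 1) =
      ∑ i ∈ Finset.range r, (b i : ℝ) / q ^ (i + 1) := by
    intro r hr q
    exact Finset.sum_congr rfl fun i hi => by rw [hdlt i (by have := Finset.mem_range.1 hi; omega)]
  have hp2 : (0:ℝ) < 2 ^ n := by positivity
  have hV2 : seqVal 2 d = x - (y n - 1 / 3) / 2 ^ n := by
    rw [V_split one_lt_two hd n, hshn, V_p01 one_lt_two, hsumd n le_rfl]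
    have := hsum n
    rw [sub_div]
    norm_num
    norm_num at this
    linarith
  have hyn := hby n hbn
  have hyn1 := (hy n).2
  have hlt2 : seqVal 2 d < x := by
    rw [hV2]
    have : 0 < (y n - 1 / 3) / 2 ^ n := div_pos (by linarith) hp2
    linarith
  set δ : ℝ := 2 ^ (i0+2) / 2 ^ n with hδ
  have hδ0 : 0 < δ := by positivity
  have hδ8 : δ ≤ 1 / 8 := by
    rw [hδ, div_le_div_iff₀ hp2 (by norm_num)]
    have : (2:ℝ) ^ (i0 + 5) ≤ 2 ^ n := pow_le_pow_right₀ one_le_two (by omega)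
    calc (2:ℝ) ^ (i0+2) * 8 = 2 ^ (i0+5) := by ring
      _ ≤ 1 * 2 ^ n := by linarith
  have hge : x ≤ seqVal (2 - δ) d := by
    have h1 := V_anti_digit (q := 2 - δ) (q' := 2) (by linarith) (by linarith) hd i0
      (by rw [hdlt i0 (by omega), hi0])
    have h2 : 1 / 2 ^ (i0+1) + δ / 2 ^ (i0+2) ≤ 1 / (2 - δ) ^ (i0+1) := by
      have hp : (0:ℝ) < 2 - δ := by linarith
      have e1 : 1 / (2 - δ) ^ (i0+1) = (2 / (2 - δ)) ^ (i0+1) / 2 ^ (i0+1) := by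
        rw [div_pow]; field_simp
      have e2 : 1 + δ / 2 ≤ 2 / (2 - δ) := by
        rw [le_div_iff₀ hp]; nlinarith
      have e3 : 2 / (2 - δ) ≤ (2 / (2 - δ)) ^ (i0+1) :=
        le_self_pow₀ (by linarith) (by omega)
      have e4 : 1 / 2 ^ (i0+1) + δ / 2 ^ (i0+2) = (1 + δ / 2) / 2 ^ (i0+1) := by
        rw [pow_succ 2 (i0+1)]; field_simp
      rw [e1, e4]
      gcongr
      linarith
    have h3 : δ / 2 ^ (i0+2) = 1 / 2 ^ n := by rw [hδ]; field_simp
    have h4 : (y n - 1 / 3) / 2 ^ n ≤ 1 / 2 ^ n := by gcongr; linarith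
    linarith
  obtain ⟨q, ⟨hq1, hq2⟩, hqx⟩ := intermediate_value_Icc' (by linarith : 2 - δ ≤ 2)
    (continuousOn_V (q₁ := 2 - δ) (by linarith) hd) ⟨hlt2.le, hge⟩
  have hqx : seqVal q d = x := hqx
  have hq2 : q < 2 := lt_of_le_of_ne hq2 (fun h => by rw [h] at hqx; linarith)
  have hq : 1 < q := by linarith
  have hq0 : 0 < q := by linarith
  have hqe : 15 / 8 ≤ q := by linarith
  have htail : ∀ k, sh (k + n + 1) d = sh (k + 1) p01 := by
    intro k; funext i
    have : i + (k + n + 1) = (i + (k + 1)) + n := by ring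
    simp only [sh]; rw [this, hdge]
  refine ⟨q, hq, hq2, (unique_iff hq hq2 x).2 ⟨d, hd, hqx.symm, ?_, ?_⟩⟩
  · intro r hr
    rcases lt_or_ge r n with hrn | hrn
    · by_contra! hcon
      have h1 := V_split hq hd (r+1)
      have h2 := hsum (r+1)
      rw [hsumd (r+1) hrn] at h1
      have h3 : ∑ i ∈ Finset.range (r+1), (b i : ℝ) / 2 ^ (i + 1) ≤
          ∑ i ∈ Finset.range (r+1), (b i : ℝ) / q ^ (i + 1) := by
        apply Finset.sum_le_sum; intro i _; gcongr
      have h4 : y (r+1) / 2 ^ (r+1) ≤ 1 / 2 ^ (r+1) := by gcongr; exact (hy (r+1)).2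
      have h5 : 1 / q ^ (r+1) ≤ seqVal q (sh (r+1) d) / q ^ (r+1) := by gcongr
      have h6 : 1 / 2 ^ (r+1) < 1 / q ^ (r+1) := by gcongr
      linarith
    · obtain ⟨k, rfl⟩ := Nat.exists_eq_add_of_le' hrn
      rw [hdge] at hr
      rw [htail]
      have : sh (k+1) p01 = cpl p01 := by
        funext i; simp only [sh, cpl, p01] at hr ⊢; omega
      rw [this]; exact V_cpl_p01_lt hqe
  · intro r hr
    have hr1 : d r = 1 := by have := hd r; simp only [cpl] at hr; omega
    rw [sh_cpl]
    rcases lt_or_ge r n with hrn | hrn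
    · have hj : ∃ j, d (j + (r+1)) = 1 ∧ j + 1 + (i0 + 3) < n := by
        rcases lt_or_ge r n0 with h | h
        · refine ⟨n0 - (r+1), ?_, by omega⟩
          rw [Nat.sub_add_cancel (by omega), hdlt n0 (by omega), hbn0]
        · refine ⟨n - r, ?_, by omega⟩
          have : n - r + (r + 1) = 1 + n := by omega
          rw [this, hdge]; rfl
      obtain ⟨j, hj1, hj2⟩ := hj
      have h1 := V_ge_digit hq (hd.sh (r+1)) j hj1
      have h2 : 1 / 2 ^ (j+1) ≤ 1 / q ^ (j+1) := by gcongr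
      have h3 : 1 / (q - 1) - 1 ≤ 2 * δ := by
        have : 0 < q - 1 := by linarith
        rw [sub_le_iff_le_add, div_le_iff₀ this]
        nlinarith
      have h4 : 2 * δ < 1 / 2 ^ (j+1) := by
        rw [hδ, ← mul_div_assoc, div_lt_div_iff₀ hp2 (by positivity)]
        have : (2:ℝ) ^ (j + 1 + (i0 + 3)) < 2 ^ n := pow_lt_pow_right₀ one_lt_two hj2
        calc (2:ℝ) * 2 ^ (i0+2) * 2 ^ (j+1) = 2 ^ (j + 1 + (i0 + 3)) := by ring
          _ < 1 * 2 ^ n := by linarith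
      rw [V_cpl hq (hd.sh _)]
      linarith
    · obtain ⟨k, rfl⟩ := Nat.exists_eq_add_of_le' hrn
      rw [hdge] at hr1
      rw [htail]
      have : cpl (sh (k+1) p01) = cpl p01 := by
        funext i; simp only [sh, cpl, p01] at hr1 ⊢; omega
      rw [this]; exact V_cpl_p01_lt hqe

end Exp

open Exp

/-- For `x > 0` and `N ≥ 1`, `x ∈ ⋃_{n=1}^N D_n` iff `q_s(x) ≤ q_N`. -/
theorem mem_union_D_iff (τ : ℕ → ℕ) (hτ : IsThueMorse τ)
    (Q : ℕ → ℝ) (hQ : IsBaseSeq τ Q)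
    (x : ℝ) (hx : 0 < x) (N : ℕ) (hN : 1 ≤ N) :
    (x ∈ ⋃ n ∈ Finset.Icc 1 N, D Q n) ↔ qs x ≤ Q N := by
  have hmono := Q_mono hτ hQ
  have hbdd : BddBelow (UBases x) := ⟨1, fun q hq => hq.1.le⟩
  constructor
  · intro h
    simp only [Set.mem_iUnion, D, Finset.mem_Icc] at h
    obtain ⟨n, ⟨hn1, hnN⟩, q, ⟨hq1, hq2⟩, -, hu⟩ := h
    have a : 1 ≤ Q (n - 1) := by rw [← hQ.1]; exact hmono.monotone (Nat.zero_le _)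
    have b := (hQ.2 n hn1).2.1
    exact (csInf_le hbdd ⟨by linarith, by linarith, hu⟩).trans
      (hq2.trans (hmono.monotone hnN))
  · intro h
    have hne := UBases_nonempty hx
    have : ∃ q ∈ UBases x, q ≤ Q N := by
      rcases h.lt_or_eq with h | h
      · obtain ⟨q, hq, hlt⟩ := exists_lt_of_csInf_lt hne h
        exact ⟨q, hq, hlt.le⟩
      · obtain ⟨M, rfl⟩ := Nat.exists_eq_add_of_le' hN
        exact ⟨_, attained hτ hQ hx M hne h, le_rfl⟩
    obtain ⟨q, ⟨hq1, hq2, hu⟩, hqN⟩ := this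
    classical
    have hex : ∃ n, q ≤ Q n := ⟨N, hqN⟩
    have hs := Nat.find_spec hex
    have hpos : 1 ≤ Nat.find hex := by
      by_contra! h0
      have h0 : Nat.find hex = 0 := by omega
      rw [h0, hQ.1] at hs
      linarith
    simp only [Set.mem_iUnion, D, Finset.mem_Icc]
    refine ⟨Nat.find hex, ⟨hpos, Nat.find_min' hex hqN⟩, q, ⟨?_, hs⟩, ?_, hu⟩
    · exact not_le.1 (Nat.find_min hex (by omega))
    · obtain ⟨d, hd, rfl, -⟩ := (unique_iff hq1 hq2 x).1 hu
      exact ⟨V_nonneg hq1 d, V_le hq1 hd⟩
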